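/- arXiv:1812.11885 — 2 statements merged into one kernel-verified Lean document; each statement's English description precedes it below -/
import Mathlib

section
/- (Harer–Zagier recursion) Let γ = (1 2 … 2d) be the standard 2d-cycle in the symmetric group S_{2d}, and for integers g ≥ 0 and d ≥ 1 let a_g(d) be the number of fixed-point-free involutions τ ∈ S_{2d} such that the permutation γ∘τ has exactly d+1−2g cycles (equivalently, a_g(d) is the number of ways to glue the edges of a 2d-gon in pairs to obtain a closed orientable surface of genus g). With the convention a_g(d) = 0 for g < 0, for all integers g ≥ 0 and d ≥ 3 one has (d+1)·a_g(d) = 2(2d−1)·a_g(d−1) + (2d−1)(d−1)(2d−3)·a_{g−1}(d−2). -/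
/-- The number of cycles of a permutation of `Fin n`, counting fixed points as cycles. -/
def cycleCount {n : ℕ} (σ : Equiv.Perm (Fin n)) : ℕ :=
  Multiset.card σ.cycleType + (n - σ.cycleType.sum)

/-- `a g d` is the number of fixed-point-free involutions `τ` in the symmetric group on
`2d` letters such that `γ ∘ τ` has exactly `d + 1 - 2g` cycles, where `γ` is the standard
`2d`-cycle; by convention it is `0` for `g < 0`. -/
noncomputable def a (g : ℤ) (d : ℕ) : ℤ :=
  if g < 0 then 0 else
    (Nat.card {τ : Equiv.Perm (Fin (2 * d)) //
      τ * τ = 1 ∧ (∀ x, τ x ≠ x) ∧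
      (cycleCount (finRotate (2 * d) * τ) : ℤ) = (d : ℤ) + 1 - 2 * g} : ℤ)

open Equiv Equiv.Perm

/-- The number of cycles of a permutation is the number of its orbits. -/
theorem cycleCount_eq_card_quotient {n : ℕ} (σ : Perm (Fin n)) :
    cycleCount σ = Nat.card (Quotient (SameCycle.setoid σ)) := by
  classical
  let φ : Fin n → Perm (Fin n) ⊕ Fin n := fun x =>
    if σ x = x then Sum.inr x else Sum.inl (σ.cycleOf x)
  have hφ : ∀ x y, φ x = φ y ↔ σ.SameCycle x y := by
    intro x y
    by_cases hx : σ x = x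
    · by_cases hy : σ y = y
      · simp only [φ, hx, hy, if_true, Sum.inr.injEq]
        refine ⟨fun h => h ▸ SameCycle.refl _ _, fun h => ?_⟩
        obtain ⟨k, rfl⟩ := h
        exact (zpow_apply_eq_self_of_apply_eq_self hx k).symm
      · simp only [φ, hx, hy, if_true, if_false, reduceCtorEq, false_iff]
        intro h
        exact hy (h.apply_eq_self_iff.1 hx)
    · by_cases hy : σ y = y
      · simp only [φ, hx, hy, if_true, if_false, reduceCtorEq, false_iff]
        intro h
        exact hx (h.apply_eq_self_iff.2 hy)
      · simp only [φ, hx, hy, if_false, Sum.inl.injEq]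
        exact (sameCycle_iff_cycleOf_eq_of_mem_support (mem_support.2 hx)
          (mem_support.2 hy)).symm
  have himage : Finset.univ.image φ = σ.cycleFactorsFinset.disjSum σ.supportᶜ := by
    ext z
    rcases z with c | x
    · simp only [Finset.mem_image, Finset.mem_univ, true_and, Finset.inl_mem_disjSum]
      constructor
      · rintro ⟨x, hx⟩
        by_cases h : σ x = x
        · simp [φ, h] at hx
        · simp only [φ, h, if_false, Sum.inl.injEq] at hx
          rw [← hx, cycleOf_mem_cycleFactorsFinset_iff, mem_support]
          exact h
      · intro hc
        obtain ⟨x, hx⟩ := (mem_cycleFactorsFinset_iff.1 hc).1.nonempty_support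
        have hs := mem_cycleFactorsFinset_support_le hc hx
        refine ⟨x, ?_⟩
        simp only [φ, mem_support.1 hs, if_false, Sum.inl.injEq]
        exact (cycle_is_cycleOf hx hc).symm
    · simp only [Finset.mem_image, Finset.mem_univ, true_and, Finset.inr_mem_disjSum,
        Finset.mem_compl, mem_support, not_not]
      constructor
      · rintro ⟨y, hy⟩
        by_cases h : σ y = y
        · simp only [φ, h, if_true, Sum.inr.injEq] at hy
          exact hy ▸ h
        · simp [φ, h] at hy
      · intro hx
        exact ⟨x, by simp [φ, hx]⟩
  let ψ : Quotient (SameCycle.setoid σ) → Perm (Fin n) ⊕ Fin n :=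
    Quotient.lift φ fun x y h => (hφ x y).2 h
  have hψ : Function.Injective ψ := by
    rintro ⟨x⟩ ⟨y⟩ h
    exact Quotient.sound ((hφ x y).1 h)
  have hrange : Set.range ψ = (Finset.univ.image φ : Finset _) := by
    ext z
    simp only [Set.mem_range, Finset.coe_image, Finset.coe_univ, Set.image_univ]
    constructor
    · rintro ⟨⟨x⟩, rfl⟩
      exact ⟨x, rfl⟩
    · rintro ⟨x, rfl⟩
      exact ⟨Quotient.mk _ x, rfl⟩
  rw [← Nat.card_range_of_injective hψ, hrange, himage]
  simp only [SetLike.coe_sort_coe, Nat.card_eq_fintype_card, Fintype.card_coe, Finset.card_disjSum,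
    Finset.card_compl, Fintype.card_fin]
  rw [cycleCount, sum_cycleType, cycleType_def, Multiset.card_map, Finset.card_val]

theorem Equiv.Perm.SameCycle.eq_of_comp_eq {α β : Type*} {σ : Perm α} {f : α → β}
    (hf : ∀ x, f (σ x) = f x) {x y : α} (h : σ.SameCycle x y) : f x = f y := by
  obtain ⟨k, rfl⟩ := h
  have hinv : ∀ x, f (σ⁻¹ x) = f x := fun x => by simpa using (hf (σ⁻¹ x)).symm
  induction k using Int.induction_on with
  | zero => simp
  | succ k ih => rw [add_comm, zpow_add, zpow_one, Perm.mul_apply, hf]; exact ih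
  | pred k ih => rw [sub_eq_neg_add, zpow_add, zpow_neg_one, Perm.mul_apply, hinv]; exact ih

theorem cycleCount_conj {n : ℕ} (σ τ : Perm (Fin n)) :
    cycleCount (τ * σ * τ⁻¹) = cycleCount σ := by
  simp [cycleCount, cycleType_conj]

theorem cycleCount_mul_comm {n : ℕ} (σ τ : Perm (Fin n)) :
    cycleCount (σ * τ) = cycleCount (τ * σ) := by
  rw [← cycleCount_conj (σ * τ) τ]
  congr 1
  group

/-- Adjoining a fixed point adds one cycle. -/
theorem cycleCount_decomposeFin_symm_zero {n : ℕ} (σ : Perm (Fin n)) :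
    cycleCount (decomposeFin.symm (0, σ)) = cycleCount σ + 1 := by
  set σ' := decomposeFin.symm (0, σ) with hσ'
  have h0 : σ' 0 = 0 := by simp [hσ']
  have hs : ∀ x : Fin n, σ' x.succ = (σ x).succ := fun x => by simp [hσ']
  rw [cycleCount_eq_card_quotient, cycleCount_eq_card_quotient, ← Finite.card_option]
  symm
  let f : Fin (n + 1) → Option (Quotient (SameCycle.setoid σ)) :=
    Fin.cases none fun x => some (Quotient.mk _ x)
  have hf : ∀ x, f (σ' x) = f x := by
    refine Fin.cases (by rw [h0]) fun x => ?_
    rw [hs]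
    exact congrArg some (Quotient.sound (SameCycle.refl σ x).apply_left)
  let g : Fin n → Quotient (SameCycle.setoid σ') := fun x => Quotient.mk _ x.succ
  have hg : ∀ x, g (σ x) = g x := fun x => Quotient.sound (by
    have := (SameCycle.refl σ' x.succ).apply_left
    rwa [hs] at this)
  refine Nat.card_congr
    { toFun := fun o => o.elim (Quotient.mk _ 0) (Quotient.lift g fun x y h =>
        SameCycle.eq_of_comp_eq hg h)
      invFun := Quotient.lift f fun x y h => SameCycle.eq_of_comp_eq hf h
      left_inv := ?_
      right_inv := ?_ }
  · rintro (_ | x)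
    · rfl
    · induction x using Quotient.ind
      rfl
  · rintro ⟨x⟩
    induction x using Fin.cases <;> rfl

/-- Inserting a new point into a cycle does not change the number of cycles. -/
theorem cycleCount_decomposeFin_symm_succ {n : ℕ} (h : Fin n) (σ : Perm (Fin n)) :
    cycleCount (decomposeFin.symm (h.succ, σ)) = cycleCount σ := by
  set σ' := decomposeFin.symm (h.succ, σ) with hσ'
  have h0 : σ' 0 = h.succ := by simp [hσ']
  have hs : ∀ x : Fin n, σ' x.succ = swap 0 h.succ (σ x).succ := fun x => by simp [hσ']
  rw [cycleCount_eq_card_quotient, cycleCount_eq_card_quotient]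
  let f : Fin (n + 1) → Quotient (SameCycle.setoid σ) :=
    Fin.cases (Quotient.mk _ h) fun x => Quotient.mk _ x
  have hf : ∀ x, f (σ' x) = f x := by
    refine Fin.cases (by rw [h0]; rfl) fun x => ?_
    have hx : (Quotient.mk (SameCycle.setoid σ) (σ x)) = Quotient.mk _ x :=
      Quotient.sound (SameCycle.refl σ x).apply_left
    rw [hs]
    by_cases e : σ x = h
    · rw [e, swap_apply_right]
      rw [e] at hx
      exact hx
    · rw [swap_apply_of_ne_of_ne (Fin.succ_ne_zero _) (by simpa using e)]
      exact hx
  let g : Fin n → Quotient (SameCycle.setoid σ') := fun x => Quotient.mk _ x.succ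
  have h0' : (Quotient.mk (SameCycle.setoid σ') h.succ) = Quotient.mk _ 0 :=
    Quotient.sound (by
      have := (SameCycle.refl σ' 0).apply_left
      rwa [h0] at this)
  have hg : ∀ x, g (σ x) = g x := fun x => by
    have hx : (Quotient.mk (SameCycle.setoid σ') (σ' x.succ)) = Quotient.mk _ x.succ :=
      Quotient.sound (SameCycle.refl σ' x.succ).apply_left
    rw [hs] at hx
    by_cases e : σ x = h
    · rw [e, swap_apply_right] at hx
      simp only [g, e]
      rw [h0', hx]
    · rwa [swap_apply_of_ne_of_ne (Fin.succ_ne_zero _) (by simpa using e)] at hx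
  refine Nat.card_congr
    { toFun := Quotient.lift f fun x y h => SameCycle.eq_of_comp_eq hf h
      invFun := Quotient.lift g fun x y h => SameCycle.eq_of_comp_eq hg h
      left_inv := ?_
      right_inv := ?_ }
  · rintro ⟨x⟩
    induction x using Fin.cases
    · exact h0'
    · rfl
  · rintro ⟨x⟩
    rfl

theorem decomposeFin_symm_zero_mul {n : ℕ} (k : Fin n) (σ ρ : Perm (Fin n)) :
    (decomposeFin.symm (0, σ) * decomposeFin.symm (k.succ, ρ) : Perm (Fin (n + 1))) =
      decomposeFin.symm ((σ k).succ, σ * ρ) := by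
  ext x
  induction x using Fin.cases with
  | zero => simp
  | succ x =>
    simp only [Perm.mul_apply, decomposeFin_symm_apply_succ]
    by_cases e : ρ x = k
    · simp [e]
    · rw [swap_apply_of_ne_of_ne (Fin.succ_ne_zero _) (by simpa using e),
        swap_apply_of_ne_of_ne (Fin.succ_ne_zero _) (by simpa using e)]
      simp

theorem decomposeFin_symm_succ_mul_of_eq {n : ℕ} (k : Fin n) (σ ρ : Perm (Fin n)) :
    (decomposeFin.symm ((σ k).succ, σ) * decomposeFin.symm (k.succ, ρ) : Perm (Fin (n + 1))) =
      decomposeFin.symm (0, σ * ρ) := by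
  ext x
  induction x using Fin.cases with
  | zero => simp
  | succ x =>
    simp only [Perm.mul_apply, decomposeFin_symm_apply_succ]
    by_cases e : ρ x = k
    · simp [e]
    · rw [swap_apply_of_ne_of_ne (Fin.succ_ne_zero _) (by simpa using e)]
      simp only [decomposeFin_symm_apply_succ]
      rw [swap_apply_of_ne_of_ne (Fin.succ_ne_zero _) (by simpa using e)]
      simp

theorem decomposeFin_symm_succ_mul_of_ne {n : ℕ} (b k : Fin n) (σ ρ : Perm (Fin n))
    (h : σ k ≠ b) :
    (decomposeFin.symm (b.succ, σ) * decomposeFin.symm (k.succ, ρ) : Perm (Fin (n + 1))) =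
      decomposeFin.symm ((σ k).succ, swap b (σ k) * σ * ρ) := by
  ext x
  induction x using Fin.cases with
  | zero =>
    simp only [Perm.mul_apply, decomposeFin_symm_apply_succ, decomposeFin_symm_apply_zero]
    rw [swap_apply_of_ne_of_ne (Fin.succ_ne_zero _) (by simpa using h)]
  | succ x =>
    simp only [Perm.mul_apply, decomposeFin_symm_apply_succ]
    by_cases e : ρ x = k
    · simp only [e, swap_apply_right, decomposeFin_symm_apply_zero]
      rw [swap_apply_of_ne_of_ne (Fin.succ_ne_zero _) (by simpa using h.symm)]
    · rw [swap_apply_of_ne_of_ne (Fin.succ_ne_zero _) (by simpa using e)]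
      simp only [decomposeFin_symm_apply_succ]
      by_cases e' : σ (ρ x) = b
      · simp [e']
      · rw [swap_apply_of_ne_of_ne (Fin.succ_ne_zero _) (by simpa using e'),
          swap_apply_of_ne_of_ne (a := b) e' (by simpa using e),
          swap_apply_of_ne_of_ne (Fin.succ_ne_zero _) (by simpa using e)]

section Determinant

open Matrix Finset

theorem Derivation.leibniz_finset_prod {R A ι : Type*} [CommRing R] [CommRing A] [Algebra R A]
    [DecidableEq ι] (D : Derivation R A A) (s : Finset ι) (f : ι → A) :
    D (∏ i ∈ s, f i) = ∑ i ∈ s, D (f i) * ∏ j ∈ s.erase i, f j := by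
  induction s using Finset.induction_on with
  | empty => simp
  | insert k s hk ih =>
    rw [prod_insert hk, D.leibniz, ih, sum_insert hk, erase_insert hk, smul_eq_mul, smul_eq_mul,
      mul_sum, add_comm, mul_comm]
    refine congrArg _ (sum_congr rfl fun i hi => ?_)
    have hki : k ≠ i := fun h => hk (h ▸ hi)
    rw [erase_insert_of_ne hki, prod_insert (fun h => hk (mem_of_mem_erase h))]
    ring

/-- The Jacobi formula for the derivative of a determinant. -/
theorem Derivation.map_det {R A ι : Type*} [CommRing R] [CommRing A] [Algebra R A]
    [DecidableEq ι] [Fintype ι] (D : Derivation R A A) (M : Matrix ι ι A) :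
    D M.det = (M.adjugate * M.map D).trace := by
  have key : ∀ k, (M.adjugate * M.map D) k k = (M.updateCol k fun i => D (M i k)).det := by
    intro k
    rw [← cramer_apply, cramer_eq_adjugate_mulVec]
    rfl
  rw [trace]
  simp only [diag_apply, key, det_apply]
  rw [map_sum, sum_comm]
  refine sum_congr rfl fun σ _ => ?_
  rw [Units.smul_def, map_zsmul, D.leibniz_finset_prod, smul_sum]
  refine sum_congr rfl fun k _ => ?_
  rw [Units.smul_def, ← mul_prod_erase univ _ (mem_univ k)]
  congr 2
  · simp
  · exact prod_congr rfl fun j hj => by rw [updateCol_ne (ne_of_mem_erase hj)]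

open PowerSeries

/-- The matrix `1 - X P` over the ring of power series, where `P` is the matrix of `w`. -/
noncomputable def oneSubXPerm {n : ℕ} (w : Perm (Fin n)) : Matrix (Fin n) (Fin n) ℚ⟦X⟧ :=
  Matrix.of fun i j => (if i = j then 1 else 0) - (if w i = j then X else 0)

theorem oneSubXPerm_apply {n : ℕ} (w : Perm (Fin n)) (i j : Fin n) :
    oneSubXPerm w i j = (if i = j then 1 else 0) - (if w i = j then X else 0) := rfl

theorem constantCoeff_det_oneSubXPerm {n : ℕ} (w : Perm (Fin n)) :
    constantCoeff (oneSubXPerm w).det = 1 := by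
  rw [RingHom.map_det]
  convert det_one (n := Fin n) (R := ℚ)
  ext i j : 1
  simp only [RingHom.mapMatrix_apply, map_apply, oneSubXPerm_apply, map_sub, Matrix.one_apply]
  split_ifs <;> simp

theorem isUnit_det_oneSubXPerm {n : ℕ} (w : Perm (Fin n)) : IsUnit (oneSubXPerm w).det := by
  rw [isUnit_iff_constantCoeff, constantCoeff_det_oneSubXPerm]
  exact isUnit_one

theorem one_sub_X_mul_inv : (1 - X : ℚ⟦X⟧) * (1 - X)⁻¹ = 1 :=
  PowerSeries.mul_inv_cancel _ (by simp)

theorem sum_row_oneSubXPerm_inv {n : ℕ} (w : Perm (Fin n)) (i : Fin n) :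
    ∑ j, (oneSubXPerm w)⁻¹ i j = (1 - X)⁻¹ := by
  have h : oneSubXPerm w *ᵥ (fun _ => 1) = fun _ => 1 - X := by
    ext1 i
    simp [mulVec, dotProduct, oneSubXPerm_apply]
  have h2 : (oneSubXPerm w)⁻¹ *ᵥ (fun _ => 1 - X) = fun _ => 1 := by
    rw [← h, mulVec_mulVec, nonsing_inv_mul _ (isUnit_det_oneSubXPerm w), one_mulVec]
  have h3 := congrFun h2 i
  simp only [mulVec, dotProduct, ← sum_mul] at h3
  linear_combination (1 - X)⁻¹ * h3 - (∑ j, (oneSubXPerm w)⁻¹ i j) * one_sub_X_mul_inv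

theorem sum_col_oneSubXPerm_inv {n : ℕ} (w : Perm (Fin n)) (j : Fin n) :
    ∑ i, (oneSubXPerm w)⁻¹ i j = (1 - X)⁻¹ := by
  have h : (fun _ => 1) ᵥ* oneSubXPerm w = fun _ => 1 - X := by
    ext1 j
    simp only [vecMul, dotProduct, oneSubXPerm_apply, one_mul, sum_sub_distrib]
    simp [← Equiv.eq_symm_apply]
  have h2 : (fun _ => 1 - X) ᵥ* (oneSubXPerm w)⁻¹ = fun _ => 1 := by
    rw [← h, vecMul_vecMul, mul_nonsing_inv _ (isUnit_det_oneSubXPerm w), vecMul_one]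
  have h3 := congrFun h2 j
  simp only [vecMul, dotProduct, ← mul_sum] at h3
  linear_combination (1 - X)⁻¹ * h3 - (∑ i, (oneSubXPerm w)⁻¹ i j) * one_sub_X_mul_inv

/-- The effect of a transposition on `det (1 - X P)`, a rank-one perturbation. -/
theorem det_oneSubXPerm_swap_mul {n : ℕ} (w : Perm (Fin n)) {b h : Fin n} (hbh : h ≠ b) :
    (oneSubXPerm (swap b h * w)).det = (oneSubXPerm w).det *
      ((oneSubXPerm w)⁻¹ b b + (oneSubXPerm w)⁻¹ h h - (oneSubXPerm w)⁻¹ b h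
        - (oneSubXPerm w)⁻¹ h b - 1) := by
  set A := oneSubXPerm w with hA
  have hu := isUnit_det_oneSubXPerm w
  let v : Fin n → ℚ⟦X⟧ := Pi.single b 1 - Pi.single h 1
  have hfac : oneSubXPerm (swap b h * w) =
      A * (1 + replicateCol Unit ((A⁻¹ - 1) *ᵥ v) * replicateRow Unit v) := by
    rw [replicateCol_mulVec, Matrix.mul_add, mul_one, ← Matrix.mul_assoc, ← Matrix.mul_assoc,
      Matrix.mul_sub, mul_nonsing_inv _ hu, mul_one]
    ext i j : 1
    simp only [oneSubXPerm_apply, Matrix.add_apply, hA, Perm.mul_apply,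
      Matrix.mul_apply, Matrix.sub_apply, Matrix.one_apply, replicateCol_apply,
      replicateRow_apply, v, Pi.sub_apply, Pi.single_apply]
    simp only [sub_sub_cancel, Finset.univ_unique, Finset.sum_singleton, ite_mul, zero_mul,
      Finset.sum_ite_eq, Finset.mem_univ, if_true]
    rcases eq_or_ne (w i) b with h1 | h1
    · simp only [h1, swap_apply_left, if_true, hbh.symm, if_false]
      simp only [eq_comm (a := j)]
      ring_nf
      split_ifs <;> ring
    · rcases eq_or_ne (w i) h with h2 | h2
      · simp only [h2, swap_apply_right, if_true, hbh, if_false]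
        simp only [eq_comm (a := j)]
        split_ifs <;> ring
      · simp [swap_apply_of_ne_of_ne h1 h2, h1, h2]
  rw [hfac, det_mul, det_one_add_replicateCol_mul_replicateRow]
  congr 1
  simp only [v, mulVec_sub, dotProduct_sub, sub_dotProduct, mulVec_single_one,
    single_one_dotProduct, col_apply, Matrix.sub_apply, Matrix.one_apply, if_true, hbh, hbh.symm,
    if_false]
  ring

theorem sum_det_oneSubXPerm_swap_mul {n : ℕ} (w : Perm (Fin n)) (b : Fin n) :
    ∑ h ∈ univ.erase b, (oneSubXPerm (swap b h * w)).det = (oneSubXPerm w).det *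
      (n * (oneSubXPerm w)⁻¹ b b + (oneSubXPerm w)⁻¹.trace - 2 * (1 - X)⁻¹ - n + 1) := by
  rw [sum_congr rfl fun h hh => det_oneSubXPerm_swap_mul w (ne_of_mem_erase hh), ← mul_sum]
  congr 1
  have := add_sum_erase univ (fun h => (oneSubXPerm w)⁻¹ b b + (oneSubXPerm w)⁻¹ h h -
    (oneSubXPerm w)⁻¹ b h - (oneSubXPerm w)⁻¹ h b - 1) (mem_univ b)
  simp only [sum_sub_distrib, sum_add_distrib, sum_row_oneSubXPerm_inv,
    sum_col_oneSubXPerm_inv] at this ⊢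
  simp only [sum_const, card_univ, Fintype.card_fin, nsmul_eq_mul, trace, diag_apply] at this ⊢
  linear_combination this

theorem X_mul_derivative_det_oneSubXPerm {n : ℕ} (w : Perm (Fin n)) :
    X * d⁄dX ℚ (oneSubXPerm w).det =
      (oneSubXPerm w).det * ((n : ℚ⟦X⟧) - (oneSubXPerm w)⁻¹.trace) := by
  have hu := isUnit_det_oneSubXPerm w
  have hD : (X : ℚ⟦X⟧) • (oneSubXPerm w).map (d⁄dX ℚ) = oneSubXPerm w - 1 := by
    ext i j : 1
    simp only [Matrix.smul_apply, map_apply, oneSubXPerm_apply, Matrix.sub_apply,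
      Matrix.one_apply, map_sub, apply_ite (d⁄dX ℚ), derivative_X, map_zero,
      Derivation.map_one_eq_zero, smul_eq_mul]
    split_ifs <;> simp
  have hadj : (oneSubXPerm w).adjugate = (oneSubXPerm w).det • (oneSubXPerm w)⁻¹ := by
    rw [Matrix.inv_def, smul_smul, Ring.mul_inverse_cancel _ hu, one_smul]
  rw [Derivation.map_det, ← smul_eq_mul, ← trace_smul, ← Matrix.mul_smul, hD, hadj, smul_mul,
    trace_smul, Matrix.mul_sub, nonsing_inv_mul _ hu, mul_one, trace_sub, trace_one,
    Fintype.card_fin, smul_eq_mul]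

theorem det_oneSubXPerm_decomposeFin_symm_zero {n : ℕ} (w : Perm (Fin n)) :
    (oneSubXPerm (decomposeFin.symm (0, w))).det = (1 - X) * (oneSubXPerm w).det := by
  rw [det_succ_row_zero, Fin.sum_univ_succ]
  have h : (oneSubXPerm (decomposeFin.symm (0, w))).submatrix Fin.succ (Fin.succAbove 0) =
      oneSubXPerm w := by
    ext i j : 1
    simp [oneSubXPerm_apply]
  rw [h]
  simp [oneSubXPerm_apply, (Fin.succ_ne_zero _).symm]

theorem inv_oneSubXPerm_decomposeFin_symm_zero {n : ℕ} (w : Perm (Fin n)) :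
    (oneSubXPerm (decomposeFin.symm (0, w)))⁻¹ = Matrix.of
      (Fin.cons (Fin.cons (1 - X)⁻¹ 0) fun i => Fin.cons 0 ((oneSubXPerm w)⁻¹ i)) := by
  refine inv_eq_right_inv ?_
  ext i j : 1
  rw [Matrix.mul_apply, Fin.sum_univ_succ]
  induction i using Fin.cases with
  | zero =>
    induction j using Fin.cases with
    | zero => simp [oneSubXPerm_apply, (Fin.succ_ne_zero _).symm]
    | succ j => simp [oneSubXPerm_apply, (Fin.succ_ne_zero _).symm]
  | succ i =>
    induction j using Fin.cases with
    | zero => simp [oneSubXPerm_apply]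
    | succ j =>
      have := congrFun (congrFun (mul_nonsing_inv _ (isUnit_det_oneSubXPerm w)) i) j
      rw [Matrix.mul_apply] at this
      simp only [oneSubXPerm_apply] at this
      simp [oneSubXPerm_apply, Matrix.one_apply] at this ⊢
      exact this

theorem decomposeFin_symm_eq_swap_mul {n : ℕ} (p : Fin (n + 1)) (w : Perm (Fin n)) :
    (decomposeFin.symm (p, w) : Perm (Fin (n + 1))) = swap 0 p * decomposeFin.symm (0, w) := by
  ext x
  induction x using Fin.cases <;> simp

theorem det_oneSubXPerm_decomposeFin_symm_succ {n : ℕ} (b : Fin n) (w : Perm (Fin n)) :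
    (oneSubXPerm (decomposeFin.symm (b.succ, w))).det =
      (oneSubXPerm w).det * (1 + (1 - X) * ((oneSubXPerm w)⁻¹ b b - 1)) := by
  rw [decomposeFin_symm_eq_swap_mul, det_oneSubXPerm_swap_mul _ (Fin.succ_ne_zero b),
    det_oneSubXPerm_decomposeFin_symm_zero, inv_oneSubXPerm_decomposeFin_symm_zero]
  simp only [of_apply, Fin.cons_zero, Fin.cons_succ, Pi.zero_apply]
  linear_combination (oneSubXPerm w).det * one_sub_X_mul_inv

end Determinant

section FullCycles

open Finset PowerSeries

/-- The sum of `q ^ cycleCount (w * ρ)` over all permutations `ρ` with a single cycle. -/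
noncomputable def fullCycleSum {n : ℕ} (w : Perm (Fin n)) (q : ℕ) : ℚ :=
  ∑ ρ : Perm (Fin n), if cycleCount ρ = 1 then (q : ℚ) ^ cycleCount (w * ρ) else 0

theorem cycleCount_ne_zero {n : ℕ} (σ : Perm (Fin (n + 1))) : cycleCount σ ≠ 0 := by
  rw [cycleCount_eq_card_quotient]
  have : Nonempty (Quotient (SameCycle.setoid σ)) := ⟨Quotient.mk _ 0⟩
  exact Nat.card_pos.ne'

theorem fullCycleSum_succ {n : ℕ} (w : Perm (Fin (n + 2))) (q : ℕ) :
    fullCycleSum w q = ∑ k : Fin (n + 1), ∑ ρ : Perm (Fin (n + 1)),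
      if cycleCount ρ = 1 then
        (q : ℚ) ^ cycleCount (w * decomposeFin.symm (k.succ, ρ) : Perm (Fin (n + 2))) else 0 := by
  rw [fullCycleSum, ← decomposeFin.symm.sum_comp, Fintype.sum_prod_type, Fin.sum_univ_succ]
  simp [cycleCount_decomposeFin_symm_zero, cycleCount_decomposeFin_symm_succ, cycleCount_ne_zero]

theorem fullCycleSum_decomposeFin_symm_zero {n : ℕ} (w : Perm (Fin (n + 1))) (q : ℕ) :
    fullCycleSum (decomposeFin.symm (0, w)) q = (n + 1) * fullCycleSum w q := by
  rw [fullCycleSum_succ]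
  simp_rw [decomposeFin_symm_zero_mul, cycleCount_decomposeFin_symm_succ]
  simp [fullCycleSum]

theorem fullCycleSum_decomposeFin_symm_succ {n : ℕ} (b : Fin (n + 1)) (w : Perm (Fin (n + 1)))
    (q : ℕ) :
    fullCycleSum (decomposeFin.symm (b.succ, w)) q =
      q * fullCycleSum w q + ∑ h ∈ univ.erase b, fullCycleSum (swap b h * w) q := by
  rw [fullCycleSum_succ, ← w.symm.sum_comp, ← add_sum_erase _ _ (mem_univ b)]
  congr 1
  · rw [fullCycleSum, mul_sum]
    refine sum_congr rfl fun ρ _ => ?_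
    have := decomposeFin_symm_succ_mul_of_eq (w.symm b) w ρ
    rw [Equiv.apply_symm_apply] at this
    rw [this, cycleCount_decomposeFin_symm_zero, pow_succ', mul_ite, mul_zero]
  · refine sum_congr rfl fun h hh => sum_congr rfl fun ρ _ => ?_
    have := decomposeFin_symm_succ_mul_of_ne b (w.symm h) w ρ
    rw [Equiv.apply_symm_apply] at this
    rw [this (ne_of_mem_erase hh), cycleCount_decomposeFin_symm_succ]

theorem PowerSeries.mk_natCast_mul (f : ℕ → ℚ) :
    (PowerSeries.mk fun q => (q : ℚ) * f q) = X * d⁄dX ℚ (PowerSeries.mk f) := by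
  ext q
  cases q with
  | zero => simp
  | succ q => simp [coeff_succ_X_mul, coeff_derivative, mul_comm]

theorem derivative_inv_one_sub_X :
    d⁄dX ℚ (1 - X : ℚ⟦X⟧)⁻¹ = (1 - X : ℚ⟦X⟧)⁻¹ ^ 2 := by
  simp

theorem PowerSeries.mk_natCast :
    (PowerSeries.mk fun q : ℕ => (q : ℚ)) = X * (1 - X : ℚ⟦X⟧)⁻¹ ^ 2 := by
  have h : (PowerSeries.mk fun _ => (1 : ℚ)) = (1 - X : ℚ⟦X⟧)⁻¹ := by
    have := mk_one_mul_one_sub_eq_one ℚ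
    have h1 : (PowerSeries.mk fun _ => (1 : ℚ)) = PowerSeries.mk 1 := rfl
    rw [h1]
    linear_combination (1 - X : ℚ⟦X⟧)⁻¹ * this - PowerSeries.mk 1 * one_sub_X_mul_inv
  simpa [h, derivative_inv_one_sub_X] using PowerSeries.mk_natCast_mul fun _ => 1

theorem mk_fullCycleSum {n : ℕ} (w : Perm (Fin (n + 1))) :
    PowerSeries.mk (fullCycleSum w) =
      (n.factorial : ℚ⟦X⟧) * X * (oneSubXPerm w).det * (1 - X)⁻¹ ^ (n + 3) := by
  induction n with
  | zero =>
    have hF : fullCycleSum w = fun q : ℕ => (q : ℚ) := by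
      have h : Subsingleton (Perm (Fin (0 + 1))) := inferInstanceAs (Subsingleton (Perm (Fin 1)))
      have hc (σ : Perm (Fin (0 + 1))) : cycleCount σ = 1 := by
        rw [h.elim σ 1]
        simp [cycleCount]
      have hu : (univ : Finset (Perm (Fin (0 + 1)))) = {1} := by
        ext σ
        simp [h.elim σ 1]
      ext q
      rw [fullCycleSum, hu, sum_singleton, if_pos (hc _), hc, pow_one]
    have hdet : (oneSubXPerm w).det = 1 - X := by
      simp [oneSubXPerm_apply, eq_iff_true_of_subsingleton]
    rw [hF, hdet, PowerSeries.mk_natCast]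
    simp only [Nat.factorial_zero, Nat.cast_one, zero_add]
    linear_combination -X * (1 - X : ℚ⟦X⟧)⁻¹ ^ 2 * one_sub_X_mul_inv
  | succ n ih =>
    obtain ⟨⟨p, w⟩, rfl⟩ := decomposeFin.symm.surjective w
    rw [Nat.factorial_succ]
    induction p using Fin.cases with
    | zero =>
      have h : PowerSeries.mk (fullCycleSum (decomposeFin.symm (0, w))) =
          ((n : ℚ⟦X⟧) + 1) * PowerSeries.mk (fullCycleSum w) := by
        have hc : ((n : ℚ⟦X⟧) + 1) = C ((n : ℚ) + 1) := by simp
        ext q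
        rw [hc, coeff_C_mul, coeff_mk, coeff_mk, fullCycleSum_decomposeFin_symm_zero]
      rw [h, ih, det_oneSubXPerm_decomposeFin_symm_zero]
      push_cast
      linear_combination -((n : ℚ⟦X⟧) + 1) * n.factorial * X * (oneSubXPerm w).det *
        (1 - X : ℚ⟦X⟧)⁻¹ ^ (n + 3) * one_sub_X_mul_inv
    | succ b =>
      have h : PowerSeries.mk (fullCycleSum (decomposeFin.symm (b.succ, w))) =
          X * d⁄dX ℚ (PowerSeries.mk (fullCycleSum w)) +
            ∑ h ∈ univ.erase b, PowerSeries.mk (fullCycleSum (swap b h * w)) := by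
        rw [← PowerSeries.mk_natCast_mul]
        ext q
        simp [fullCycleSum_decomposeFin_symm_succ]
      rw [h, ih, det_oneSubXPerm_decomposeFin_symm_succ]
      simp_rw [ih]
      rw [← sum_mul, ← mul_sum, sum_det_oneSubXPerm_swap_mul]
      have hψ := X_mul_derivative_det_oneSubXPerm w
      have hc : d⁄dX ℚ (n.factorial : ℚ⟦X⟧) = 0 := Derivation.map_natCast _ _
      simp only [Derivation.leibniz, derivative_pow, derivative_inv_one_sub_X, derivative_X, hc,
        smul_eq_mul]
      have hU := one_sub_X_mul_inv
      set U := (1 - X : ℚ⟦X⟧)⁻¹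
      set ψ := (oneSubXPerm w).det
      set g := (oneSubXPerm w)⁻¹ b b
      rw [Nat.add_sub_cancel (n := n + 2) (m := 1)]
      push_cast at hψ ⊢
      linear_combination (n.factorial : ℚ⟦X⟧) * X * U ^ (n + 3) * hψ -
        (n.factorial : ℚ⟦X⟧) * X * U ^ (n + 3) * ψ * (2 + ((n : ℚ⟦X⟧) + 1) * g) * hU

theorem card_cycleCount_eq_one (n : ℕ) :
    #{ρ : Perm (Fin (n + 1)) | cycleCount ρ = 1} = n.factorial := by
  have h := congrArg (coeff 1) (mk_fullCycleSum (1 : Perm (Fin (n + 1))))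
  rw [coeff_mk, mul_assoc, mul_assoc, ← map_natCast (C (R := ℚ)), coeff_C_mul,
    coeff_succ_X_mul, coeff_zero_eq_constantCoeff_apply, map_mul, constantCoeff_det_oneSubXPerm]
    at h
  simp only [fullCycleSum, Nat.cast_one, one_pow, sum_boole, map_pow, constantCoeff_inv, map_sub,
    constantCoeff_one, constantCoeff_X, sub_zero, inv_one, mul_one] at h
  exact_mod_cast h

end FullCycles

section Involutions

open Finset PowerSeries

theorem one_sub_X_sq_mul_inv : (1 - X ^ 2 : ℚ⟦X⟧) * (1 - X ^ 2)⁻¹ = 1 :=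
  PowerSeries.mul_inv_cancel _ (by simp)

theorem inv_oneSubXPerm_of_involution {n : ℕ} {τ : Perm (Fin n)} (hτ : τ * τ = 1) :
    (oneSubXPerm τ)⁻¹ = Matrix.of fun i j =>
      ((if i = j then 1 else 0) + (if τ i = j then X else 0)) * (1 - X ^ 2)⁻¹ := by
  refine Matrix.inv_eq_right_inv ?_
  have h2 : ∀ i, τ (τ i) = i := fun i => by rw [← Perm.mul_apply, hτ, Perm.one_apply]
  ext i j : 1
  simp only [Matrix.mul_apply, oneSubXPerm_apply, Matrix.of_apply, sub_mul, sum_sub_distrib,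
    ite_mul, zero_mul, one_mul, sum_ite_eq, mem_univ, if_true, h2, Matrix.one_apply]
  have h := one_sub_X_sq_mul_inv
  split_ifs <;> first | linear_combination h | ring1

theorem det_oneSubXPerm_of_involution {d : ℕ} {τ : Perm (Fin (2 * d))} (hτ : τ * τ = 1)
    (hfix : ∀ x, τ x ≠ x) : (oneSubXPerm τ).det = (1 - X ^ 2) ^ d := by
  set ψ := (oneSubXPerm τ).det with hψ
  set V := (1 - X ^ 2 : ℚ⟦X⟧)⁻¹ with hV
  have htr : (oneSubXPerm τ)⁻¹.trace = 2 * d * V := by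
    rw [inv_oneSubXPerm_of_involution hτ, Matrix.trace]
    simp [hfix, hV]
  have hD : d⁄dX ℚ ψ = -(2 * (d : ℚ⟦X⟧) * X * V * ψ) := by
    have h := X_mul_derivative_det_oneSubXPerm τ
    rw [htr, ← hψ] at h
    push_cast at h
    refine mul_left_cancel₀ (X_ne_zero (R := ℚ)) ?_
    linear_combination h - 2 * (d : ℚ⟦X⟧) * ψ * one_sub_X_sq_mul_inv
  have hDV : d⁄dX ℚ V = 2 * X * V ^ 2 := by
    rw [hV, derivative_inv']
    simp only [map_sub, Derivation.map_one_eq_zero, derivative_pow, derivative_X]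
    ring
  have hVd : ψ * V ^ d = 1 := by
    refine derivative.ext ?_ ?_
    · rw [Derivation.leibniz, derivative_pow, hD, hDV, Derivation.map_one_eq_zero]
      simp only [smul_eq_mul]
      cases d with
      | zero => simp
      | succ d =>
        rw [Nat.add_sub_cancel]
        ring
    · rw [map_mul, hψ, constantCoeff_det_oneSubXPerm]
      simp [hV]
  calc ψ = ψ * ((1 - X ^ 2) * V) ^ d := by rw [hV, one_sub_X_sq_mul_inv, one_pow, mul_one]
    _ = (1 - X ^ 2) ^ d * (ψ * V ^ d) := by rw [mul_pow]; ring
    _ = _ := by rw [hVd, mul_one]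

theorem mk_fullCycleSum_of_involution {d : ℕ} {τ : Perm (Fin (2 * (d + 1)))} (hτ : τ * τ = 1)
    (hfix : ∀ x, τ x ≠ x) : PowerSeries.mk (fullCycleSum τ) =
      ((2 * d + 1).factorial : ℚ⟦X⟧) * (X * (1 + X) ^ (d + 1) * (1 - X)⁻¹ ^ (d + 3)) := by
  rw [mk_fullCycleSum (n := 2 * d + 1) τ, det_oneSubXPerm_of_involution (d := d + 1) hτ hfix]
  set U := (1 - X : ℚ⟦X⟧)⁻¹ with hU
  have h : ((1 - X) * U) ^ (d + 1) = 1 := by rw [hU, one_sub_X_mul_inv, one_pow]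
  have h2 : (1 - X ^ 2 : ℚ⟦X⟧) = (1 - X) * (1 + X) := by ring
  rw [h2]
  calc
    _ = ((2 * d + 1).factorial : ℚ⟦X⟧) * (X * (1 + X) ^ (d + 1) * U ^ (d + 3)) *
        ((1 - X) * U) ^ (d + 1) := by
      simp only [mul_pow]
      ring
    _ = _ := by rw [h, mul_one]

/-- The fixed-point-free involutions of `2 * d` letters. -/
def fixedPointFreeInvolutions (d : ℕ) : Finset (Perm (Fin (2 * d))) :=
  {τ | τ * τ = 1 ∧ ∀ x, τ x ≠ x}

theorem mem_fixedPointFreeInvolutions {d : ℕ} {τ : Perm (Fin (2 * d))} :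
    τ ∈ fixedPointFreeInvolutions d ↔ τ * τ = 1 ∧ ∀ x, τ x ≠ x := by
  simp [fixedPointFreeInvolutions]

theorem mem_fixedPointFreeInvolutions_iff_cycleType {d : ℕ} {τ : Perm (Fin (2 * d))} :
    τ ∈ fixedPointFreeInvolutions d ↔ τ.cycleType = Multiset.replicate d 2 := by
  rw [mem_fixedPointFreeInvolutions]
  constructor
  · rintro ⟨h, hfix⟩
    have hr := cycleType_of_pow_prime_eq_one (p := 2) (σ := τ) (by rw [pow_two, h])
    have hs : τ.support = univ := by
      ext x
      simp [hfix x]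
    have hsum := sum_cycleType τ
    rw [hs, card_univ, Fintype.card_fin, hr, Multiset.sum_replicate, smul_eq_mul] at hsum
    rw [hr]
    congr 1
    omega
  · intro h
    refine ⟨?_, ?_⟩
    · rw [← pow_two, pow_prime_eq_one_iff (p := 2), h]
      exact fun c hc => Multiset.eq_of_mem_replicate hc
    · have hsum := sum_cycleType τ
      rw [h, Multiset.sum_replicate, smul_eq_mul, mul_comm] at hsum
      have hs : τ.support = univ := by
        rw [← card_eq_iff_eq_univ, ← hsum, Fintype.card_fin]
      intro x
      rw [← mem_support, hs]
      exact mem_univ x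

theorem card_fixedPointFreeInvolutions_mul (d : ℕ) :
    #(fixedPointFreeInvolutions d) * (2 ^ d * d.factorial) = (2 * d).factorial := by
  have h := Equiv.Perm.card_of_cycleType_mul_eq (α := Fin (2 * d)) (Multiset.replicate d 2)
  rw [if_pos ⟨by simp [mul_comm], fun c hc => (Multiset.eq_of_mem_replicate hc).ge⟩] at h
  have hI : ({g | g.cycleType = Multiset.replicate d 2} : Finset (Perm (Fin (2 * d)))) =
      fixedPointFreeInvolutions d := by
    ext τ
    rw [mem_fixedPointFreeInvolutions_iff_cycleType]
    simp
  rw [hI, Fintype.card_fin] at h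
  rw [← h]
  rcases d with _ | d
  · simp
  · simp only [Multiset.sum_replicate, Multiset.prod_replicate, Multiset.toFinset_replicate,
      Nat.succ_ne_zero, if_false, prod_singleton, Multiset.count_replicate_self, smul_eq_mul]
    simp [mul_comm]

theorem card_fixedPointFreeInvolutions_succ (d : ℕ) :
    #(fixedPointFreeInvolutions (d + 1)) = (2 * d + 1) * #(fixedPointFreeInvolutions d) := by
  have h := card_fixedPointFreeInvolutions_mul d
  have h' := card_fixedPointFreeInvolutions_mul (d + 1)
  have hf : (2 * (d + 1)).factorial = (2 * d + 2) * ((2 * d + 1) * (2 * d).factorial) := by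
    rw [show 2 * (d + 1) = 2 * d + 1 + 1 by ring, Nat.factorial_succ, Nat.factorial_succ]
  rw [hf, ← h, Nat.factorial_succ] at h'
  have hpos : 0 < 2 ^ d * d.factorial * (2 * (d + 1)) := by positivity
  refine Nat.eq_of_mul_eq_mul_right hpos ?_
  rw [pow_succ] at h'
  linarith

theorem cycleCount_eq_one_iff {n : ℕ} (hn : 2 ≤ n) {ρ : Perm (Fin n)} :
    cycleCount ρ = 1 ↔ ρ.cycleType = {n} := by
  constructor
  · intro h
    have hle := sum_cycleType_le ρ
    rw [Fintype.card_fin] at hle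
    rw [cycleCount] at h
    have hcard : Multiset.card ρ.cycleType = 1 := by
      by_contra hne
      have h0 : ρ.cycleType = 0 := Multiset.card_eq_zero.1 (by omega)
      rw [h0] at h
      simp at h
      omega
    obtain ⟨x, hx⟩ := Multiset.card_eq_one.1 hcard
    rw [hx] at h hle ⊢
    simp at h hle
    congr 1
    omega
  · intro h
    simp [cycleCount, h]

/-- The generating polynomial of the number of cycles of `γ * τ`, with `γ` the standard cycle and
`τ` a fixed-point-free involution. -/
noncomputable def gluingPolynomial (d : ℕ) : Polynomial ℚ :=
  ∑ τ ∈ fixedPointFreeInvolutions d, Polynomial.X ^ cycleCount (finRotate (2 * d) * τ)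

theorem sum_pow_cycleCount_eq_of_isConj {d : ℕ} {γ ρ : Perm (Fin (2 * d))} (h : IsConj γ ρ)
    (q : ℚ) : ∑ τ ∈ fixedPointFreeInvolutions d, q ^ cycleCount (τ * ρ) =
      ∑ τ ∈ fixedPointFreeInvolutions d, q ^ cycleCount (γ * τ) := by
  obtain ⟨c, rfl⟩ := isConj_iff.1 h
  symm
  refine sum_equiv (MulAut.conj c).toEquiv (fun τ => ?_) fun τ _ => ?_
  · simp only [mem_fixedPointFreeInvolutions_iff_cycleType]
    simp [cycleType_conj]
  · rw [cycleCount_mul_comm, ← cycleCount_conj _ c]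
    congr 2
    simp [mul_assoc]

theorem factorial_mul_eval_gluingPolynomial (d q : ℕ) :
    ((2 * d + 1).factorial : ℚ) * (gluingPolynomial (d + 1)).eval (q : ℚ) =
      ∑ τ ∈ fixedPointFreeInvolutions (d + 1), fullCycleSum τ q := by
  simp only [fullCycleSum, ← sum_filter]
  rw [sum_comm]
  have hconj : ∀ ρ ∈ ({ρ | cycleCount ρ = 1} : Finset (Perm (Fin (2 * (d + 1))))),
      ∑ τ ∈ fixedPointFreeInvolutions (d + 1), (q : ℚ) ^ cycleCount (τ * ρ) =
        (gluingPolynomial (d + 1)).eval (q : ℚ) := by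
    intro ρ hρ
    have h2 : 2 ≤ 2 * (d + 1) := by omega
    rw [mem_filter_univ, cycleCount_eq_one_iff h2] at hρ
    rw [sum_pow_cycleCount_eq_of_isConj (γ := finRotate (2 * (d + 1))), gluingPolynomial,
      Polynomial.eval_finsetSum]
    · simp
    · rw [isConj_iff_cycleType_eq, hρ, cycleType_finRotate_of_le h2]
  rw [sum_congr rfl hconj, sum_const, nsmul_eq_mul]
  congr 2
  exact (card_cycleCount_eq_one (2 * d + 1)).symm

/-- The polynomials `s d` with `∑ s d (q) X ^ q = X (1 + X) ^ d / (1 - X) ^ (d + 2)`. -/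
noncomputable def harerZagierPolynomial : ℕ → Polynomial ℚ
  | 0 => Polynomial.X
  | 1 => Polynomial.X ^ 2
  | d + 2 => Polynomial.C ((d : ℚ) + 3)⁻¹ *
      (2 * Polynomial.X * harerZagierPolynomial (d + 1) +
        Polynomial.C ((d : ℚ) + 1) * harerZagierPolynomial d)

theorem harerZagierPolynomial_add_two (d : ℕ) :
    Polynomial.C ((d : ℚ) + 3) * harerZagierPolynomial (d + 2) =
      2 * Polynomial.X * harerZagierPolynomial (d + 1) +
        Polynomial.C ((d : ℚ) + 1) * harerZagierPolynomial d := by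
  have h : ((d : ℚ) + 3) ≠ 0 := by positivity
  rw [harerZagierPolynomial, ← mul_assoc, ← Polynomial.C_mul, mul_inv_cancel₀ h, Polynomial.C_1,
    one_mul]

theorem natDegree_harerZagierPolynomial_le (d : ℕ) :
    (harerZagierPolynomial d).natDegree ≤ d + 1 := by
  induction d using Nat.twoStepInduction with
  | zero => simp [harerZagierPolynomial]
  | one => simp [harerZagierPolynomial]
  | more d ih0 ih1 =>
    rw [harerZagierPolynomial]
    refine (Polynomial.natDegree_C_mul_le _ _).trans
      (Polynomial.natDegree_add_le_of_degree_le ?_ ?_)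
    · rw [mul_assoc]
      refine (Polynomial.natDegree_mul_le_of_le (m := 0) (n := d + 3) (by simp) ?_).trans
        (by omega)
      refine (Polynomial.natDegree_mul_le_of_le (m := 1) (n := d + 2) (by simp) ih1).trans
        (by omega)
    · exact (Polynomial.natDegree_C_mul_le _ _).trans (by omega)

theorem mk_eval_harerZagierPolynomial (d : ℕ) :
    (PowerSeries.mk fun q : ℕ => (harerZagierPolynomial d).eval (q : ℚ)) =
      X * (1 + X) ^ d * (1 - X)⁻¹ ^ (d + 2) := by
  have hU := one_sub_X_mul_inv
  induction d using Nat.twoStepInduction with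
  | zero => simpa [harerZagierPolynomial] using PowerSeries.mk_natCast
  | one =>
    have h : (PowerSeries.mk fun q : ℕ => (harerZagierPolynomial 1).eval (q : ℚ)) =
        X * d⁄dX ℚ (X * (1 - X : ℚ⟦X⟧)⁻¹ ^ 2) := by
      rw [← PowerSeries.mk_natCast, ← PowerSeries.mk_natCast_mul]
      ext q
      simp [harerZagierPolynomial, pow_two]
    rw [h]
    simp only [Derivation.leibniz, derivative_pow, derivative_inv_one_sub_X, derivative_X,
      smul_eq_mul]
    set U := (1 - X : ℚ⟦X⟧)⁻¹
    push_cast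
    linear_combination -X * U ^ 2 * hU
  | more d ih0 ih1 =>
    have h3 : ((d : ℚ⟦X⟧) + 3) = C ((d : ℚ) + 3) := by rw [map_add, map_natCast, map_ofNat]
    have h : ((d : ℚ⟦X⟧) + 3) *
        (PowerSeries.mk fun q : ℕ => (harerZagierPolynomial (d + 2)).eval (q : ℚ)) =
        2 * (X * d⁄dX ℚ (X * (1 + X) ^ (d + 1) * (1 - X)⁻¹ ^ (d + 1 + 2))) +
          ((d : ℚ⟦X⟧) + 1) * (X * (1 + X) ^ d * (1 - X)⁻¹ ^ (d + 2)) := by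
      rw [← ih0, ← ih1, ← PowerSeries.mk_natCast_mul]
      have h1 : ((d : ℚ⟦X⟧) + 1) = C ((d : ℚ) + 1) := by simp
      have h2 : (2 : ℚ⟦X⟧) = C (2 : ℚ) := (map_ofNat C 2).symm
      ext q
      rw [h3, h1, h2, (coeff q).map_add, coeff_C_mul, coeff_C_mul, coeff_C_mul]
      simp only [coeff_mk]
      have := congrArg (Polynomial.eval (q : ℚ)) (harerZagierPolynomial_add_two d)
      simp only [Polynomial.eval_add, Polynomial.eval_mul, Polynomial.eval_C, Polynomial.eval_X,
        Polynomial.eval_ofNat] at this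
      linear_combination this
    have h0 : ((d : ℚ⟦X⟧) + 3) ≠ 0 := by
      rw [h3, Ne, map_eq_zero_iff C C_injective]
      positivity
    refine mul_left_cancel₀ h0 (h.trans ?_)
    simp only [Derivation.leibniz, derivative_pow, derivative_inv_one_sub_X, derivative_X,
      smul_eq_mul, map_add, Derivation.map_one_eq_zero]
    set U := (1 - X : ℚ⟦X⟧)⁻¹
    rw [Nat.add_sub_cancel, show d + 1 + 2 - 1 = d + 2 by omega]
    push_cast
    linear_combination -(X * (1 + X) ^ d * U ^ (d + 2)) *
      (2 * (((d : ℚ⟦X⟧) + 2) * X + 1) * U + ((d : ℚ⟦X⟧) + 1) * (1 + (1 - X) * U)) * hU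

theorem gluingPolynomial_succ (d : ℕ) : gluingPolynomial (d + 1) =
    Polynomial.C (#(fixedPointFreeInvolutions (d + 1)) : ℚ) * harerZagierPolynomial (d + 1) := by
  have heval : ∀ q : ℕ, (gluingPolynomial (d + 1)).eval (q : ℚ) =
      (Polynomial.C (#(fixedPointFreeInvolutions (d + 1)) : ℚ) *
        harerZagierPolynomial (d + 1)).eval (q : ℚ) := by
    intro q
    have hf : ((2 * d + 1).factorial : ℚ) ≠ 0 := by positivity
    refine mul_left_cancel₀ hf ?_
    rw [factorial_mul_eval_gluingPolynomial]
    have hτ : ∀ τ ∈ fixedPointFreeInvolutions (d + 1), fullCycleSum τ q =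
        (2 * d + 1).factorial * (harerZagierPolynomial (d + 1)).eval (q : ℚ) := by
      intro τ hτ
      rw [mem_fixedPointFreeInvolutions] at hτ
      have h := mk_fullCycleSum_of_involution hτ.1 hτ.2
      rw [← mk_eval_harerZagierPolynomial, ← map_natCast (C (R := ℚ))] at h
      have := congrArg (coeff q) h
      rwa [coeff_C_mul, coeff_mk, coeff_mk] at this
    rw [sum_congr rfl hτ, sum_const, nsmul_eq_mul, Polynomial.eval_mul, Polynomial.eval_C]
    ring
  refine Polynomial.eq_of_infinite_eval_eq _ _ ?_
  refine (Set.infinite_range_of_injective (Nat.cast_injective (R := ℚ))).mono ?_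
  rintro _ ⟨q, rfl⟩
  exact heval q

theorem coeff_gluingPolynomial (d k : ℕ) : (gluingPolynomial d).coeff k =
    #{τ ∈ fixedPointFreeInvolutions d | cycleCount (finRotate (2 * d) * τ) = k} := by
  rw [gluingPolynomial, Polynomial.finsetSum_coeff]
  simp [Polynomial.coeff_X_pow, eq_comm]

/-- The coefficient of a polynomial at an integer exponent, zero for negative exponents. -/
noncomputable def Polynomial.intCoeff (p : Polynomial ℚ) (k : ℤ) : ℚ :=
  if 0 ≤ k then p.coeff k.toNat else 0

theorem intCoeff_harerZagierPolynomial_add_two (d : ℕ) (k : ℤ) :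
    ((d : ℚ) + 3) * (harerZagierPolynomial (d + 2)).intCoeff k =
      2 * (harerZagierPolynomial (d + 1)).intCoeff (k - 1) +
        ((d : ℚ) + 1) * (harerZagierPolynomial d).intCoeff k := by
  rcases lt_or_ge k 0 with hk | hk
  · simp [Polynomial.intCoeff, hk.not_ge, show ¬ (1 : ℤ) ≤ k by omega]
  · lift k to ℕ using hk
    have h := congrArg (fun p => Polynomial.coeff p k) (harerZagierPolynomial_add_two d)
    have h2 : (2 : Polynomial ℚ) = Polynomial.C 2 := rfl
    simp only [Polynomial.coeff_add, Polynomial.coeff_C_mul, h2, mul_assoc] at h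
    cases k with
    | zero => simpa [Polynomial.intCoeff] using h
    | succ k =>
      rw [Polynomial.coeff_X_mul] at h
      have hk : ((k + 1 : ℕ) : ℤ) - 1 = k := by push_cast; ring
      rw [hk]
      simp only [Polynomial.intCoeff, Int.natCast_nonneg, if_true, Int.toNat_natCast]
      exact h

theorem a_eq_intCoeff (g : ℤ) (d : ℕ) : (a g (d + 1) : ℚ) =
    #(fixedPointFreeInvolutions (d + 1)) *
      (harerZagierPolynomial (d + 1)).intCoeff (((d + 1 : ℕ) : ℤ) + 1 - 2 * g) := by
  rw [a]
  split_ifs with hg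
  · have hdeg := natDegree_harerZagierPolynomial_le (d + 1)
    rw [Polynomial.intCoeff, if_pos (by omega), Polynomial.coeff_eq_zero_of_natDegree_lt (by omega)]
    simp
  · rw [Polynomial.intCoeff]
    split_ifs with hk
    · rw [← Polynomial.coeff_C_mul, ← gluingPolynomial_succ, coeff_gluingPolynomial]
      rw [Nat.card_eq_fintype_card, Fintype.card_subtype]
      norm_cast
      congr 1
      ext τ
      simp only [mem_filter, mem_univ, true_and, mem_fixedPointFreeInvolutions, and_assoc]
      refine and_congr_right fun _ => and_congr_right fun _ => ?_
      omega
    · have : IsEmpty {τ : Equiv.Perm (Fin (2 * (d + 1))) //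
          τ * τ = 1 ∧ (∀ x, τ x ≠ x) ∧
          (cycleCount (finRotate (2 * (d + 1)) * τ) : ℤ) = ((d + 1 : ℕ) : ℤ) + 1 - 2 * g} :=
        ⟨fun τ => hk (by have := τ.2.2.2; omega)⟩
      rw [Nat.card_of_isEmpty]
      simp

end Involutions

/-- The Harer–Zagier recursion for the one-face ribbon graph numbers. -/
theorem harer_zagier (g : ℤ) (d : ℕ) (hg : 0 ≤ g) (hd : 3 ≤ d) :
    ((d : ℤ) + 1) * a g d =
      2 * (2 * (d : ℤ) - 1) * a g (d - 1) +
        (2 * (d : ℤ) - 1) * ((d : ℤ) - 1) * (2 * (d : ℤ) - 3) * a (g - 1) (d - 2) := by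
  obtain ⟨e, rfl⟩ := Nat.exists_eq_add_of_le' hd
  rw [show e + 3 - 1 = e + 1 + 1 by omega, show e + 3 - 2 = e + 1 by omega,
    show e + 3 = e + 2 + 1 by omega]
  have h := intCoeff_harerZagierPolynomial_add_two (e + 1) (((e + 2 + 1 : ℕ) : ℤ) + 1 - 2 * g)
  have h1 := card_fixedPointFreeInvolutions_succ (e + 2)
  have h2 := card_fixedPointFreeInvolutions_succ (e + 1)
  qify
  qify at h1 h2
  rw [a_eq_intCoeff, a_eq_intCoeff, a_eq_intCoeff, h1, h2]
  rw [show ((e + 1 + 1 : ℕ) : ℤ) + 1 - 2 * g = ((e + 2 + 1 : ℕ) : ℤ) + 1 - 2 * g - 1 by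
      push_cast; ring,
    show ((e + 1 : ℕ) : ℤ) + 1 - 2 * (g - 1) = ((e + 2 + 1 : ℕ) : ℤ) + 1 - 2 * g by
      push_cast; ring]
  push_cast at h ⊢
  linear_combination (2 * ((e : ℚ) + 2) + 1) * (2 * ((e : ℚ) + 1) + 1) *
    (fixedPointFreeInvolutions (e + 1)).card * h
end

section
/- (Closure properties of holonomic sequences, Proposition 4.2) Let K be a field of characteristic zero and let a, b : ℕ → K be holonomic sequences over K. Then: (a) for any α, β ∈ K the sequence n ↦ α·a(n) + β·b(n) is holonomic over K; (b) the Cauchy product n ↦ Σ_{k=0}^{n} a(k)·b(n−k) and the Hadamard product n ↦ a(n)·b(n) are holonomic over K; (c) the forward shift n ↦ a(n+1) is holonomic over K; (d) the sequence of partial sums n ↦ Σ_{k=0}^{n} a(k) is holonomic over K. -/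
/-- A sequence `a : ℕ → K` is holonomic over `K` if it satisfies a nontrivial linear
recurrence `Σ_{i=0}^r p_i(d) · a(d+i) = 0` with polynomial coefficients `p_i ∈ K[x]`,
not all zero. -/
def Holonomic {K : Type*} [Field K] (a : ℕ → K) : Prop :=
  ∃ (r : ℕ) (p : ℕ → Polynomial K),
    (∃ i ≤ r, p i ≠ 0) ∧
    ∀ d : ℕ, ∑ i ∈ Finset.range (r + 1), (p i).eval (d : K) * a (d + i) = 0

open Polynomial

/-- The elements of a module having a nonzero multiple in the submodule `N`. -/
def Submodule.saturation {R M : Type*} [CommRing R] [IsDomain R] [AddCommGroup M] [Module R M]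
    (N : Submodule R M) : Submodule R M where
  carrier := {m | ∃ q : R, q ≠ 0 ∧ q • m ∈ N}
  zero_mem' := ⟨1, one_ne_zero, by simp⟩
  add_mem' := by
    rintro x y ⟨p, hp, hx⟩ ⟨q, hq, hy⟩
    refine ⟨p * q, mul_ne_zero hp hq, ?_⟩
    rw [smul_add]
    refine N.add_mem ?_ ?_
    · rw [mul_comm, mul_smul]
      exact N.smul_mem _ hx
    · rw [mul_smul]
      exact N.smul_mem _ hy
  smul_mem' := by
    rintro c x ⟨q, hq, hx⟩
    refine ⟨q, hq, ?_⟩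
    rw [smul_comm]
    exact N.smul_mem _ hx

section Saturation

variable {R M : Type*} [CommRing R] [IsDomain R] [AddCommGroup M] [Module R M]

theorem Submodule.le_saturation (N : Submodule R M) : N ≤ N.saturation :=
  fun x hx => ⟨1, one_ne_zero, by simpa using hx⟩

theorem Submodule.saturation_mono {N N' : Submodule R M} (h : N ≤ N') :
    N.saturation ≤ N'.saturation :=
  fun _ ⟨q, hq, hx⟩ => ⟨q, hq, h hx⟩

theorem Submodule.mem_saturation_of_smul_mem {N : Submodule R M} {q : R} (hq : q ≠ 0) {x : M}
    (h : q • x ∈ N.saturation) : x ∈ N.saturation := by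
  obtain ⟨p, hp, hx⟩ := h
  exact ⟨p * q, mul_ne_zero hp hq, by rwa [mul_smul]⟩

theorem Submodule.mul_mem_saturation {A : Type*} [CommRing A] [Algebra R A]
    {N N' : Submodule R A} {x y : A} (hx : x ∈ N.saturation) (hy : y ∈ N'.saturation) :
    x * y ∈ (N * N').saturation := by
  obtain ⟨p, hp, hx⟩ := hx
  obtain ⟨q, hq, hy⟩ := hy
  refine ⟨p * q, mul_ne_zero hp hq, ?_⟩
  rw [← smul_mul_smul_comm]
  exact Submodule.mul_mem_mul hx hy

variable (R) in
/-- The iterates of `m` under `T` span a module of finite rank. -/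
def IteratesFiniteRank (T : M → M) (m : M) : Prop :=
  ∃ N : Submodule R M, N.FG ∧ ∀ j, T^[j] m ∈ N.saturation

variable (R) in
/-- The iterates of `m` under `T` satisfy a nontrivial `R`-linear relation. -/
def IteratesDependent (T : M → M) (m : M) : Prop :=
  ∃ (r : ℕ) (p : ℕ → R), (∃ i ≤ r, p i ≠ 0) ∧
    ∑ i ∈ Finset.range (r + 1), p i • T^[i] m = 0

theorem IteratesDependent.iteratesFiniteRank {T : M → M} {σ δ : R → R}
    (hadd : ∀ x y, T (x + y) = T x + T y)
    (hσ : ∀ p, p ≠ 0 → σ p ≠ 0) (hT : ∀ p x, T (p • x) = σ p • T x + δ p • x) {m : M}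
    (h : IteratesDependent R T m) : IteratesFiniteRank R T m := by
  classical
  obtain ⟨r, p, ⟨i, hi, hpi⟩, hrel⟩ := h
  set s := Nat.findGreatest (fun i => p i ≠ 0) r with hs
  have hps : p s ≠ 0 := Nat.findGreatest_spec (P := fun i => p i ≠ 0) hi hpi
  have hsr : s ≤ r := Nat.findGreatest_le r
  have hrel' : ∑ i ∈ Finset.range (s + 1), p i • T^[i] m = 0 := by
    rw [← hrel]
    refine Finset.sum_subset (fun x hx => ?_) (fun x hx hx' => ?_)
    · simp only [Finset.mem_range] at *
      omega
    · simp only [Finset.mem_range] at *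
      have : p x = 0 := by
        by_contra h0
        exact Nat.findGreatest_is_greatest (P := fun i => p i ≠ 0) (n := r) (k := x)
          (by omega) (by omega) h0
      rw [this, zero_smul]
  set N : Submodule R M := Submodule.span R ((fun i => T^[i] m) '' Set.Iio s) with hN
  have hlt : ∀ i < s, T^[i] m ∈ N := fun i hi => Submodule.subset_span ⟨i, hi, rfl⟩
  have hle : ∀ i ≤ s, T^[i] m ∈ N.saturation := by
    intro i hi
    rcases hi.lt_or_eq with hi | rfl
    · exact N.le_saturation (hlt i hi)
    · refine ⟨p s, hps, ?_⟩
      rw [Finset.sum_range_succ, add_comm] at hrel'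
      rw [eq_neg_of_add_eq_zero_left hrel']
      exact N.neg_mem (N.sum_mem fun i hi => N.smul_mem _ (hlt i (Finset.mem_range.1 hi)))
  have hTN : ∀ x ∈ N, T x ∈ N.saturation := by
    intro x hx
    induction hx using Submodule.span_induction with
    | mem x hx =>
      obtain ⟨i, hi, rfl⟩ := hx
      have := hle (i + 1) hi
      rwa [Function.iterate_succ_apply'] at this
    | zero =>
      have h0 : T 0 = 0 := by simpa using hadd 0 0
      simp [h0]
    | add x y _ _ hx hy =>
      rw [hadd]
      exact add_mem hx hy
    | smul c x hxN hx =>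
      rw [hT]
      exact add_mem (Submodule.smul_mem _ _ hx)
        (Submodule.smul_mem _ _ (N.le_saturation hxN))
  have hTsat : ∀ x ∈ N.saturation, T x ∈ N.saturation := by
    rintro x ⟨q, hq, hx⟩
    refine Submodule.mem_saturation_of_smul_mem (hσ q hq) ?_
    rw [eq_sub_of_add_eq (hT q x).symm]
    exact sub_mem (hTN _ hx) (Submodule.smul_mem _ _ ⟨q, hq, hx⟩)
  refine ⟨N, Submodule.fg_span ((Set.finite_Iio s).image _), fun j => ?_⟩
  induction j with
  | zero => exact hle 0 (Nat.zero_le _)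
  | succ j ih =>
    rw [Function.iterate_succ_apply']
    exact hTsat _ ih

theorem IteratesFiniteRank.iteratesDependent {T : M → M} {m : M}
    (h : IteratesFiniteRank R T m) : IteratesDependent R T m := by
  obtain ⟨N, hN, hsat⟩ := h
  obtain ⟨n, f, rfl⟩ := Submodule.fg_iff_exists_fin_generating_family.1 hN
  choose q hq hmem using hsat
  choose c hc using fun j => (Submodule.mem_span_range_iff_exists_fun R).1 (hmem j)
  let L : (Fin (n + 1) → R) →ₗ[R] (Fin n → R) :=
    Fintype.linearCombination R (fun j : Fin (n + 1) => c j)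
  have hL : ¬ Function.Injective L := fun hinj => by
    have := card_le_of_injective R L hinj
    simp at this
  obtain ⟨v, hv, hv0⟩ : ∃ v, L v = 0 ∧ v ≠ 0 := by
    by_contra! hcon
    exact hL ((injective_iff_map_eq_zero L).2 hcon)
  obtain ⟨j, hj⟩ := Function.ne_iff.1 hv0
  refine ⟨n, fun i => if h : i < n + 1 then v ⟨i, h⟩ * q i else 0, ⟨j, by omega, ?_⟩, ?_⟩
  · simp only [j.isLt, dif_pos]
    exact mul_ne_zero hj (hq j)
  · rw [Finset.sum_range]
    have : ∀ i : Fin (n + 1), v i • (q i • T^[i] m) = ∑ k, (v i * c i k) • f k := by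
      intro i
      rw [← hc, Finset.smul_sum]
      simp only [mul_smul]
    simp only [Fin.is_lt, dif_pos, Fin.eta, mul_smul (v _) (q _), this]
    rw [Finset.sum_comm]
    refine Finset.sum_eq_zero fun k _ => ?_
    rw [← Finset.sum_smul]
    have hk := congrFun hv k
    simp only [L, Fintype.linearCombination_apply, Finset.sum_apply, Pi.smul_apply,
      smul_eq_mul, Pi.zero_apply] at hk
    rw [hk, zero_smul]

end Saturation

section Sequences

variable {K : Type*} [Field K]

/-- Polynomials act on sequences through their values at natural numbers. -/
noncomputable abbrev sequenceAlgebra (K : Type*) [Field K] : Algebra K[X] (ℕ → K) :=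
  (RingHom.pi fun n : ℕ => evalRingHom (n : K)).toAlgebra

attribute [local instance] sequenceAlgebra

theorem polynomial_smul_sequence_apply (p : K[X]) (a : ℕ → K) (n : ℕ) :
    (p • a) n = p.eval (n : K) * a n := by
  rw [Algebra.smul_def]
  rfl

/-- The forward shift of sequences. -/
def sequenceShift (K : Type*) [Field K] : (ℕ → K) →+* (ℕ → K) where
  toFun a n := a (n + 1)
  map_one' := rfl
  map_mul' _ _ := rfl
  map_zero' := rfl
  map_add' _ _ := rfl

theorem sequenceShift_iterate_apply (a : ℕ → K) (j n : ℕ) :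
    (sequenceShift K)^[j] a n = a (n + j) := by
  induction j generalizing n with
  | zero => rfl
  | succ j ih =>
    rw [Function.iterate_succ_apply']
    change (sequenceShift K)^[j] a (n + 1) = _
    rw [ih, add_right_comm, add_assoc]

theorem sequenceShift_smul (p : K[X]) (a : ℕ → K) :
    sequenceShift K (p • a) = p.comp (X + 1) • sequenceShift K a := by
  ext n
  change (p • a) (n + 1) = _
  simp [polynomial_smul_sequence_apply, sequenceShift]

theorem holonomic_iff_iteratesDependent (a : ℕ → K) :
    Holonomic a ↔ IteratesDependent K[X] (sequenceShift K) a := by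
  unfold Holonomic IteratesDependent
  simp [funext_iff, polynomial_smul_sequence_apply, sequenceShift_iterate_apply]

theorem holonomic_iff_iteratesFiniteRank (a : ℕ → K) :
    Holonomic a ↔ IteratesFiniteRank K[X] (sequenceShift K) a := by
  rw [holonomic_iff_iteratesDependent]
  refine ⟨fun h => ?_, fun h => h.iteratesDependent⟩
  refine IteratesDependent.iteratesFiniteRank (σ := fun p => p.comp (X + 1)) (δ := 0)
    (map_add _) (fun p hp h0 => hp ?_)
    (fun p x => by simpa using sequenceShift_smul p x) h
  rw [← C_1, comp_eq_zero_iff] at h0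
  rcases h0 with h0 | ⟨-, h0⟩
  · exact h0
  · simpa using congrArg (coeff · 1) h0

theorem Holonomic.linear_combination {a b : ℕ → K} (ha : Holonomic a) (hb : Holonomic b)
    (α β : K) : Holonomic (fun n => α * a n + β * b n) := by
  rw [holonomic_iff_iteratesFiniteRank] at *
  obtain ⟨N, hN, ha⟩ := ha
  obtain ⟨N', hN', hb⟩ := hb
  refine ⟨N ⊔ N', hN.sup hN', fun j => ?_⟩
  have : (sequenceShift K)^[j] (fun n => α * a n + β * b n) =
      (C α : K[X]) • (sequenceShift K)^[j] a + (C β : K[X]) • (sequenceShift K)^[j] b := by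
    ext n
    simp [polynomial_smul_sequence_apply, sequenceShift_iterate_apply]
  rw [this]
  exact add_mem (Submodule.smul_mem _ _ (Submodule.saturation_mono le_sup_left (ha j)))
    (Submodule.smul_mem _ _ (Submodule.saturation_mono le_sup_right (hb j)))

theorem Holonomic.hadamard_mul {a b : ℕ → K} (ha : Holonomic a) (hb : Holonomic b) :
    Holonomic (fun n => a n * b n) := by
  rw [holonomic_iff_iteratesFiniteRank] at *
  obtain ⟨N, hN, ha⟩ := ha
  obtain ⟨N', hN', hb⟩ := hb
  refine ⟨N * N', hN.mul hN', fun j => ?_⟩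
  have : (sequenceShift K)^[j] (fun n => a n * b n) =
      (sequenceShift K)^[j] a * (sequenceShift K)^[j] b := by
    ext n
    simp [sequenceShift_iterate_apply]
  rw [this]
  exact Submodule.mul_mem_saturation (ha j) (hb j)

theorem Holonomic.shift {a : ℕ → K} (ha : Holonomic a) : Holonomic (fun n => a (n + 1)) := by
  rw [holonomic_iff_iteratesFiniteRank] at *
  obtain ⟨N, hN, ha⟩ := ha
  exact ⟨N, hN, fun j => ha (j + 1)⟩

theorem Holonomic.partial_sums {a : ℕ → K} (ha : Holonomic a) :
    Holonomic (fun n => ∑ k ∈ Finset.range (n + 1), a k) := by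
  rw [holonomic_iff_iteratesFiniteRank] at *
  obtain ⟨N, hN, ha⟩ := ha
  set s : ℕ → K := fun n => ∑ k ∈ Finset.range (n + 1), a k with hs
  refine ⟨N ⊔ Submodule.span K[X] {s}, hN.sup (Submodule.fg_span_singleton s), fun j => ?_⟩
  induction j with
  | zero =>
    exact Submodule.le_saturation _
      ((le_sup_right : _ ≤ N ⊔ _) (Submodule.mem_span_singleton_self s))
  | succ j ih =>
    have : (sequenceShift K)^[j + 1] s =
        (sequenceShift K)^[j] s + (sequenceShift K)^[j + 1] a := by
      ext n
      simp only [Pi.add_apply, sequenceShift_iterate_apply, hs]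
      rw [← add_assoc n j 1, Finset.sum_range_succ _ (n + j + 1)]
    rw [this]
    exact add_mem ih (Submodule.saturation_mono le_sup_left (ha (j + 1)))

end Sequences

section GeneratingFunctions

variable {K : Type*} [Field K]

/-- The Euler derivation `X d/dX` on power series. -/
noncomputable def eulerDerivation (K : Type*) [Field K] :
    Derivation K (PowerSeries K) (PowerSeries K) :=
  (PowerSeries.X : PowerSeries K) • PowerSeries.derivative K

theorem coeff_eulerDerivation (F : PowerSeries K) (n : ℕ) :
    PowerSeries.coeff n (eulerDerivation K F) = n * PowerSeries.coeff n F := by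
  cases n with
  | zero => simp [eulerDerivation]
  | succ n =>
    simp [eulerDerivation, PowerSeries.coeff_succ_X_mul, PowerSeries.coeff_derivative, mul_comm]

theorem coeff_eulerDerivation_iterate (F : PowerSeries K) (j n : ℕ) :
    PowerSeries.coeff n ((eulerDerivation K)^[j] F) = n ^ j * PowerSeries.coeff n F := by
  induction j with
  | zero => simp
  | succ j ih => rw [Function.iterate_succ_apply', coeff_eulerDerivation, ih, pow_succ']; ring

theorem polynomial_smul_powerSeries (p : K[X]) (F : PowerSeries K) :
    p • F = (p : PowerSeries K) * F := by
  rw [Algebra.smul_def, PowerSeries.algebraMap_apply', Algebra.algebraMap_self, PowerSeries.map_id]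
  rfl

theorem coeff_polynomial_smul {q : K[X]} {J : ℕ} (hq : q.natDegree ≤ J) (F : PowerSeries K)
    (n : ℕ) : PowerSeries.coeff n (q • F) =
      ∑ j ∈ Finset.range (J + 1),
        if j ≤ n then q.coeff j * PowerSeries.coeff (n - j) F else 0 := by
  conv_lhs => rw [q.as_sum_range_C_mul_X_pow' (Nat.lt_succ_of_le hq)]
  rw [Finset.sum_smul, map_sum]
  refine Finset.sum_congr rfl fun j _ => ?_
  rw [polynomial_smul_powerSeries, coe_mul, coe_C, coe_pow, coe_X, mul_assoc,
    PowerSeries.coeff_C_mul, PowerSeries.coeff_X_pow_mul', mul_ite, mul_zero]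

theorem eulerDerivation_polynomial_smul (p : K[X]) (F : PowerSeries K) :
    eulerDerivation K (p • F) =
      p • eulerDerivation K F + (X * derivative p) • F := by
  simp only [polynomial_smul_powerSeries, Derivation.leibniz, smul_eq_mul, coe_mul, coe_X,
    ← PowerSeries.derivative_coe, eulerDerivation, Derivation.smul_apply]
  ring

theorem Holonomic.iteratesDependent_eulerDerivation {a : ℕ → K} (ha : Holonomic a) :
    IteratesDependent K[X] (eulerDerivation K) (PowerSeries.mk a) := by
  obtain ⟨r, p, ⟨k₀, hk₀, hp⟩, hrec⟩ := ha
  let P : K[X] := ∏ m ∈ Finset.range r, (X + C ((m : K) + 1))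
  have hP : P ≠ 0 := Finset.prod_ne_zero_iff.2 fun m _ => X_add_C_ne_zero _
  have hPeval : ∀ n < r, P.eval ((n : K) - r) = 0 := by
    intro n hn
    rw [eval_prod]
    refine Finset.prod_eq_zero (i := r - 1 - n) (by simp; omega) ?_
    have : r = (r - 1 - n) + 1 + n := by omega
    have : (r : K) = ((r - 1 - n : ℕ) : K) + 1 + n := by
      exact_mod_cast congrArg (Nat.cast : ℕ → K) this
    rw [this]
    simp
  let Q : ℕ → K[X] := fun k => (P * p k).comp (X - C (k : K))
  have hQ : Q k₀ ≠ 0 := by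
    intro h0
    rw [comp_eq_zero_iff] at h0
    rcases h0 with h0 | ⟨-, h0⟩
    · exact mul_ne_zero hP hp h0
    · simpa using congrArg (coeff · 1) h0
  let D := (Finset.range (r + 1)).sup fun k => (Q k).natDegree
  have hD : ∀ k ≤ r, (Q k).natDegree ≤ D := fun k hk =>
    Finset.le_sup (f := fun k => (Q k).natDegree) (Finset.mem_range.2 (Nat.lt_succ_of_le hk))
  let q : ℕ → K[X] := fun i => ∑ j ∈ Finset.range (r + 1), C ((Q (r - j)).coeff i) * X ^ j
  have hqc : ∀ i, ∀ j ≤ r, (q i).coeff j = (Q (r - j)).coeff i := by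
    intro i j hj
    simp only [q, finsetSum_coeff, coeff_C_mul_X_pow]
    rw [Finset.sum_ite_eq, if_pos (Finset.mem_range.2 (Nat.lt_succ_of_le hj))]
  have hqd : ∀ i, (q i).natDegree ≤ r := fun i =>
    natDegree_sum_le_of_forall_le _ _ fun j hj =>
      (natDegree_C_mul_X_pow_le _ _).trans (Nat.lt_succ_iff.1 (Finset.mem_range.1 hj))
  refine ⟨D, q, ⟨(Q k₀).natDegree, hD k₀ hk₀, fun h0 => ?_⟩, ?_⟩
  · have := hqc (Q k₀).natDegree (r - k₀) (by omega)
    rw [h0, Nat.sub_sub_self hk₀, coeff_zero] at this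
    exact hQ (leadingCoeff_eq_zero.1 this.symm)
  · ext n
    simp only [map_sum, map_zero, coeff_polynomial_smul (hqd _),
      coeff_eulerDerivation_iterate, PowerSeries.coeff_mk]
    rw [Finset.sum_comm]
    have key : ∀ j ∈ Finset.range (r + 1), (∑ i ∈ Finset.range (D + 1),
        if j ≤ n then (q i).coeff j * (((n - j : ℕ) : K) ^ i * a (n - j)) else 0) =
        if j ≤ n then (P.eval ((n : K) - r) * (p (r - j)).eval ((n : K) - r)) * a (n - j)
          else 0 := by
      intro j hj
      have hj : j ≤ r := Nat.lt_succ_iff.1 (Finset.mem_range.1 hj)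
      split_ifs with hjn
      · have he : (Q (r - j)).eval ((n - j : ℕ) : K) =
            P.eval ((n : K) - r) * (p (r - j)).eval ((n : K) - r) := by
          simp only [Q, eval_comp, eval_mul, eval_sub, eval_X, eval_C]
          rw [Nat.cast_sub hj, Nat.cast_sub hjn]
          congr 2 <;> ring
        rw [← he, eval_eq_sum_range' (Nat.lt_succ_of_le (hD (r - j) (by omega))),
          Finset.sum_mul]
        refine Finset.sum_congr rfl fun i _ => ?_
        rw [hqc i j hj, mul_assoc]
      · simp
    rw [Finset.sum_congr rfl key]
    rcases lt_or_ge n r with hn | hn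
    · simp [hPeval n hn]
    · obtain ⟨d, rfl⟩ := Nat.exists_eq_add_of_le' hn
      have := hrec d
      rw [← Finset.sum_range_reflect] at this
      rw [← mul_zero (P.eval (d : K)), ← this, Finset.mul_sum]
      refine Finset.sum_congr rfl fun j hj => ?_
      have hj : j ≤ r := Nat.lt_succ_iff.1 (Finset.mem_range.1 hj)
      rw [if_pos (by omega), show r + 1 - 1 - j = r - j by omega,
        show d + (r - j) = d + r - j by omega]
      push_cast
      rw [add_sub_cancel_right, mul_assoc]

theorem holonomic_of_iteratesDependent_eulerDerivation {a : ℕ → K}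
    (ha : IteratesDependent K[X] (eulerDerivation K) (PowerSeries.mk a)) : Holonomic a := by
  obtain ⟨r, q, ⟨i₀, hi₀, hq⟩, hrel⟩ := ha
  let J := (Finset.range (r + 1)).sup fun i => (q i).natDegree
  have hJ : ∀ i ≤ r, (q i).natDegree ≤ J := fun i hi =>
    Finset.le_sup (f := fun i => (q i).natDegree) (Finset.mem_range.2 (Nat.lt_succ_of_le hi))
  let Q : ℕ → K[X] := fun k => ∑ i ∈ Finset.range (r + 1), C ((q i).coeff (J - k)) * X ^ i
  have hQc : ∀ k, ∀ i ≤ r, (Q k).coeff i = (q i).coeff (J - k) := by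
    intro k i hi
    simp only [Q, finsetSum_coeff, coeff_C_mul_X_pow]
    rw [Finset.sum_ite_eq, if_pos (Finset.mem_range.2 (Nat.lt_succ_of_le hi))]
  refine ⟨J, fun k => (Q k).comp (X + C (k : K)),
    ⟨J - (q i₀).natDegree, Nat.sub_le _ _, fun h0 => ?_⟩, fun d => ?_⟩
  · rw [comp_eq_zero_iff] at h0
    rcases h0 with h0 | ⟨-, h0⟩
    · have := hQc (J - (q i₀).natDegree) i₀ hi₀
      rw [h0, Nat.sub_sub_self (hJ i₀ hi₀), coeff_zero] at this
      exact hq (leadingCoeff_eq_zero.1 this.symm)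
    · simpa using congrArg (coeff · 1) h0
  · have := congrArg (PowerSeries.coeff (d + J)) hrel
    rw [map_sum, map_zero, Finset.sum_congr rfl fun i hi => coeff_polynomial_smul
      (hJ i (Nat.lt_succ_iff.1 (Finset.mem_range.1 hi))) _ _, Finset.sum_comm] at this
    rw [← this, ← Finset.sum_range_reflect]
    refine Finset.sum_congr rfl fun j hj => ?_
    have hj : j ≤ J := Nat.lt_succ_iff.1 (Finset.mem_range.1 hj)
    rw [show J + 1 - 1 - j = J - j by omega]
    simp only [Q, eval_comp, eval_finsetSum, eval_mul, eval_pow, eval_add, eval_X, eval_C]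
    rw [Finset.sum_mul]
    refine Finset.sum_congr rfl fun i _ => ?_
    rw [if_pos (by omega), coeff_eulerDerivation_iterate, PowerSeries.coeff_mk,
      Nat.sub_sub_self hj, show d + (J - j) = d + J - j by omega, ← Nat.cast_add,
      show d + (J - j) = d + J - j by omega, mul_assoc]

theorem holonomic_iff_iteratesFiniteRank_eulerDerivation (a : ℕ → K) :
    Holonomic a ↔ IteratesFiniteRank K[X] (eulerDerivation K) (PowerSeries.mk a) := by
  refine ⟨fun h => ?_, fun h =>
    holonomic_of_iteratesDependent_eulerDerivation h.iteratesDependent⟩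
  exact IteratesDependent.iteratesFiniteRank (σ := id)
    (δ := fun p => X * derivative p) (map_add _) (fun p hp => hp)
    eulerDerivation_polynomial_smul h.iteratesDependent_eulerDerivation

theorem IteratesFiniteRank.mul_of_derivation {R k A : Type*} [CommRing R] [IsDomain R]
    [CommRing k] [CommRing A] [Algebra R A] [Algebra k A] (D : Derivation k A A) {x y : A}
    (hx : IteratesFiniteRank R D x) (hy : IteratesFiniteRank R D y) :
    IteratesFiniteRank R D (x * y) := by
  obtain ⟨N, hN, hx⟩ := hx
  obtain ⟨N', hN', hy⟩ := hy
  refine ⟨N * N', hN.mul hN', fun n => ?_⟩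
  suffices h : ∀ i j, D^[n] (D^[i] x * D^[j] y) ∈ (N * N').saturation from h 0 0
  induction n with
  | zero => exact fun i j => Submodule.mul_mem_saturation (hx i) (hy j)
  | succ n ih =>
    intro i j
    rw [Function.iterate_succ_apply, D.leibniz, iterate_map_add, smul_eq_mul, smul_eq_mul,
      ← Function.iterate_succ_apply' D j, ← Function.iterate_succ_apply' D i, mul_comm (D^[j] y)]
    exact add_mem (ih i (j + 1)) (ih (i + 1) j)

theorem Holonomic.cauchy_mul {a b : ℕ → K} (ha : Holonomic a) (hb : Holonomic b) :
    Holonomic (fun n => ∑ k ∈ Finset.range (n + 1), a k * b (n - k)) := by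
  rw [holonomic_iff_iteratesFiniteRank_eulerDerivation] at *
  have : PowerSeries.mk (fun n => ∑ k ∈ Finset.range (n + 1), a k * b (n - k)) =
      PowerSeries.mk a * PowerSeries.mk b := by
    ext n
    simp [PowerSeries.coeff_mul, Finset.Nat.sum_antidiagonal_eq_sum_range_succ_mk]
  rw [this]
  exact ha.mul_of_derivation _ hb

end GeneratingFunctions

/-- Closure properties of holonomic sequences over a field of characteristic zero:
linear combinations, Cauchy products, Hadamard products, forward shifts and
partial sums of holonomic sequences are holonomic. -/
theorem holonomic_closure {K : Type*} [Field K] [CharZero K]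
    (a b : ℕ → K) (ha : Holonomic a) (hb : Holonomic b) :
    (∀ α β : K, Holonomic (fun n => α * a n + β * b n)) ∧
    Holonomic (fun n => ∑ k ∈ Finset.range (n + 1), a k * b (n - k)) ∧
    Holonomic (fun n => a n * b n) ∧
    Holonomic (fun n => a (n + 1)) ∧
    Holonomic (fun n => ∑ k ∈ Finset.range (n + 1), a k) :=
  ⟨ha.linear_combination hb, ha.cauchy_mul hb, ha.hadamard_mul hb, ha.shift, ha.partial_sums⟩
end
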